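/- Theorem 1 (shrinking-window version). Let T₀ < T, γ > 0, and let δ : (T₀,T) → (0,∞) be a decreasing function with δ(t) → 0 as t → T⁻ and limsup_{t→T⁻} (T−t)^{−γ} δ(t) = ∞. Let (u₁, ω₁, ψ₁) be a classical solution of the reduced axisymmetric Euler system on 𝒲 = {(r,z,t) : 1−δ(t) < r < 1, −δ(t) < z < δ(t), T₀ < t < T}. Suppose there exist functions U, Ω ∈ C¹(𝒟) and Ψ ∈ C²(𝒟) on the left half-plane 𝒟 such that for all (r,z,t) ∈ 𝒲: u₁(r,z,t) = (T−t)^{−1+γ/2} U(R,Z), ω₁(r,z,t) = (T−t)^{−1} Ω(R,Z), ψ₁(r,z,t) = (T−t)^{−1+2γ} Ψ(R,Z), where R = (r−1)(T−t)^{−γ} and Z = z(T−t)^{−γ}. Assume sup_{R ≤ 0} (|U(R,Z)| + |Ω(R,Z)|) → 0 as |Z| → ∞. Then u₁ ≡ 0 and ω₁ ≡ 0 on 𝒲, and there exist constants a, b ∈ ℝ such that ψ₁(r,z,t) = a (T−t)^{−1+γ} z + b (T−t)^{−1+2γ} on 𝒲. -/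

import Mathlib

open Filter Set

/-- Partial derivative in the first (radial) variable. -/
noncomputable def pdr (f : ℝ → ℝ → ℝ → ℝ) : ℝ → ℝ → ℝ → ℝ :=
  fun r z t => deriv (fun s => f s z t) r

/-- Partial derivative in the second (axial) variable. -/
noncomputable def pdz (f : ℝ → ℝ → ℝ → ℝ) : ℝ → ℝ → ℝ → ℝ :=
  fun r z t => deriv (fun s => f r s t) z

/-- Partial derivative in the time variable. -/
noncomputable def pdt (f : ℝ → ℝ → ℝ → ℝ) : ℝ → ℝ → ℝ → ℝ :=
  fun r z t => deriv (fun s => f r z s) t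

lemma deriv_scale_right (c : ℝ) (f : ℝ → ℝ) (x : ℝ) :
    deriv (fun y => f (y * c)) x = c * deriv f (x * c) := by
  have := deriv_comp_mul_left c f x
  simp only [smul_eq_mul] at this
  rw [mul_comm x c, ← this]
  congr 1; ext y; rw [mul_comm]

lemma rep_pdr (inW : ℝ → ℝ → ℝ → Prop) (f : ℝ → ℝ → ℝ → ℝ) (F : ℝ → ℝ → ℝ) (A k : ℝ → ℝ)
    (hrep : ∀ r z t, inW r z t → f r z t = A t * F ((r - 1) * k t) (z * k t))
    (r z t : ℝ) (h : ∀ᶠ q : ℝ × ℝ × ℝ in nhds (r, z, t), inW q.1 q.2.1 q.2.2) :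
    pdr f r z t = (A t * k t) * deriv (fun x => F x (z * k t)) ((r - 1) * k t) := by
  have h1 : Tendsto (fun x : ℝ => (x, z, t)) (nhds r) (nhds (r, z, t)) :=
    (Continuous.prodMk continuous_id continuous_const).tendsto r
  have h2 : (fun x => f x z t) =ᶠ[nhds r]
      fun x => A t * (fun y => (fun x => F x (z * k t)) (y * k t)) (x - 1) := by
    filter_upwards [h1.eventually h] with x hx
    exact hrep x z t hx
  unfold pdr
  rw [h2.deriv_eq, deriv_const_mul_field,
    deriv_comp_sub_const (fun y => (fun x => F x (z * k t)) (y * k t)) 1 r,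
    deriv_scale_right (k t) (fun x => F x (z * k t)) (r - 1)]
  ring

lemma rep_pdz (inW : ℝ → ℝ → ℝ → Prop) (f : ℝ → ℝ → ℝ → ℝ) (F : ℝ → ℝ → ℝ) (A k : ℝ → ℝ)
    (hrep : ∀ r z t, inW r z t → f r z t = A t * F ((r - 1) * k t) (z * k t))
    (r z t : ℝ) (h : ∀ᶠ q : ℝ × ℝ × ℝ in nhds (r, z, t), inW q.1 q.2.1 q.2.2) :
    pdz f r z t = (A t * k t) * deriv (fun x => F ((r - 1) * k t) x) (z * k t) := by
  have h1 : Tendsto (fun x : ℝ => (r, x, t)) (nhds z) (nhds (r, z, t)) :=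
    (Continuous.prodMk continuous_const
      (Continuous.prodMk continuous_id continuous_const)).tendsto z
  have h2 : (fun x => f r x t) =ᶠ[nhds z]
      fun x => A t * (fun x => F ((r - 1) * k t) x) (x * k t) := by
    filter_upwards [h1.eventually h] with x hx
    exact hrep r x t hx
  unfold pdz
  rw [h2.deriv_eq, deriv_const_mul_field,
    deriv_scale_right (k t) (fun x => F ((r - 1) * k t) x) z]
  ring

lemma window_key (T₀ T γ : ℝ) (hγ : 0 < γ)
    (δ : ℝ → ℝ)
    (hδdecr : AntitoneOn δ (Set.Ioo T₀ T))
    (hδ0 : Tendsto δ (nhdsWithin T (Set.Iio T)) (nhds 0))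
    (hδlimsup : ∀ M : ℝ, ∃ᶠ t in nhdsWithin T (Set.Iio T),
      t ∈ Set.Ioo T₀ T ∧ M < (T - t) ^ (-γ) * δ t)
    (inW : ℝ → ℝ → ℝ → Prop)
    (hinW : ∀ r z t : ℝ, inW r z t ↔
      (1 - δ t < r ∧ r < 1 ∧ -δ t < z ∧ z < δ t ∧ T₀ < t ∧ t < T))
    (R Z : ℝ) (hR : R < 0) :
    ∃ ta tb, ta < tb ∧ ∀ t ∈ Set.Ioo ta tb, t < T ∧ 0 < 1 + R * (T - t) ^ γ ∧
      ∀ᶠ q : ℝ × ℝ × ℝ in nhds (1 + R * (T - t) ^ γ, Z * (T - t) ^ γ, t),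
        inW q.1 q.2.1 q.2.2 := by
  have e1 : ∀ᶠ t in nhdsWithin T (Set.Iio T), δ t < 1 := hδ0.eventually (gt_mem_nhds one_pos)
  obtain ⟨t1, ⟨ht1, hM⟩, hlt⟩ := ((hδlimsup (|R| + |Z|)).and_eventually e1).exists
  have hτ : 0 < T - t1 := by linarith [ht1.2]
  have hM' : (|R| + |Z|) * (T - t1) ^ γ < δ t1 := by
    have hp := Real.rpow_pos_of_pos hτ γ
    rw [Real.rpow_neg hτ.le] at hM
    calc _ < ((T - t1) ^ γ)⁻¹ * δ t1 * (T - t1) ^ γ := mul_lt_mul_of_pos_right hM hp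
      _ = _ := by field_simp
  have hc : ContinuousAt (fun t : ℝ => (|R| + |Z|) * (T - t) ^ γ) t1 := by
    apply ContinuousAt.mul continuousAt_const
    exact ContinuousAt.rpow_const (by fun_prop) (Or.inr hγ.le)
  have e2 : ∀ᶠ t in nhds t1, (|R| + |Z|) * (T - t) ^ γ < δ t1 :=
    hc.eventually (gt_mem_nhds hM')
  have e3 : ∀ᶠ t in nhds t1, T₀ < t := lt_mem_nhds ht1.1
  obtain ⟨ε, hε, hb⟩ := Metric.eventually_nhds_iff.1 (e2.and e3)
  refine ⟨t1 - ε, t1, by linarith, fun t ht => ?_⟩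
  have htd : dist t t1 < ε := by
    rw [Real.dist_eq, abs_lt]; constructor <;> linarith [ht.1, ht.2]
  obtain ⟨h1, h2⟩ := hb htd
  have htT : t < T := ht.2.trans ht1.2
  have hs : 0 < (T - t) ^ γ := Real.rpow_pos_of_pos (by linarith) γ
  have hRs : -(R * (T - t) ^ γ) < δ t1 := by
    nlinarith [neg_abs_le R, abs_nonneg Z, mul_nonneg (abs_nonneg Z) hs.le,
      mul_le_mul_of_nonneg_right (neg_abs_le R) hs.le]
  have hZs1 : Z * (T - t) ^ γ < δ t1 := by
    nlinarith [mul_nonneg (abs_nonneg R) hs.le,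
      mul_le_mul_of_nonneg_right (le_abs_self Z) hs.le]
  have hZs2 : -δ t1 < Z * (T - t) ^ γ := by
    nlinarith [mul_nonneg (abs_nonneg R) hs.le,
      mul_le_mul_of_nonneg_right (neg_abs_le Z) hs.le]
  have hRs2 : R * (T - t) ^ γ < 0 := mul_neg_of_neg_of_pos hR hs
  refine ⟨htT, by linarith, ?_⟩
  have hopen : IsOpen {q : ℝ × ℝ × ℝ | 1 - δ t1 < q.1 ∧ q.1 < 1 ∧ -δ t1 < q.2.1 ∧
      q.2.1 < δ t1 ∧ T₀ < q.2.2 ∧ q.2.2 < t1} := by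
    refine IsOpen.and ?_ (IsOpen.and ?_ (IsOpen.and ?_ (IsOpen.and ?_ (IsOpen.and ?_ ?_))))
    all_goals exact isOpen_lt (by fun_prop) (by fun_prop)
  filter_upwards [hopen.mem_nhds (x := (1 + R * (T - t) ^ γ, Z * (T - t) ^ γ, t))
    ⟨by dsimp; linarith, by dsimp; linarith, hZs2, hZs1, h2, ht.2⟩] with q hq
  obtain ⟨a1, a2, a3, a4, a5, a6⟩ := hq
  have hd : δ t1 ≤ δ q.2.2 := hδdecr ⟨a5, a6.trans ht1.2⟩ ht1 a6.le
  rw [hinW]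
  exact ⟨by linarith, a2, by linarith, by linarith, a5, a6.trans ht1.2⟩

lemma const_of_deriv_zero_left (f : ℝ → ℝ) (hf : ∀ x < 0, DifferentiableAt ℝ f x)
    (h0 : ∀ x < 0, deriv f x = 0) (x : ℝ) (hx : x < 0) : f x = f (-1) := by
  have := (isOpen_Iio (a := (0:ℝ))).is_const_of_deriv_eq_zero (isPreconnected_Iio)
    (fun y hy => (hf y hy).differentiableWithinAt) (fun y hy => h0 y hy) hx
    (show (-1 : ℝ) ∈ Set.Iio (0:ℝ) by simp)
  exact this

lemma ode_part (P w : ℝ → ℝ) (hP : Differentiable ℝ P) (hP' : Differentiable ℝ (deriv P))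
    (hw : ContDiff ℝ 1 w) (h1 : ∀ Z, w Z = - deriv (deriv P) Z) (h2 : ∀ Z, P Z * deriv w Z = 0)
    (hdec : ∀ ε > 0, ∃ M : ℝ, ∀ Z, M < |Z| → |w Z| < ε) :
    (∀ Z, w Z = 0) ∧ ∃ a b, ∀ Z, P Z = a * Z + b := by
  have hw' : ∀ Z, deriv w Z = 0 := by
    intro Z
    by_contra hne
    have hc : Continuous (deriv w) := hw.continuous_deriv le_rfl
    have e1 : ∀ᶠ y in nhds Z, deriv w y ≠ 0 := hc.continuousAt.eventually_ne hne
    have e2 : P =ᶠ[nhds Z] fun _ => 0 := by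
      filter_upwards [e1] with y hy
      exact (mul_eq_zero.1 (h2 y)).resolve_right hy
    have e3 : w =ᶠ[nhds Z] fun _ => 0 := by
      have := e2.deriv.deriv
      filter_upwards [this] with y hy
      rw [h1, hy]; simp
    apply hne
    rw [e3.deriv_eq]; simp
  have hwc : ∀ x y, w x = w y := is_const_of_deriv_eq_zero (hw.differentiable one_ne_zero) hw'
  have hw0 : ∀ Z, w Z = 0 := by
    intro Z
    by_contra hne
    obtain ⟨M, hM⟩ := hdec |w Z| (abs_pos.2 hne)
    have := hM (|M| + 1) (by rw [abs_of_pos (by positivity)]; linarith [le_abs_self M])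
    rw [hwc _ Z] at this
    exact lt_irrefl _ this
  refine ⟨hw0, deriv P 0, P 0, ?_⟩
  have hd : ∀ x y, deriv P x = deriv P y := is_const_of_deriv_eq_zero hP'
    (fun Z => by have := h1 Z; rw [hw0] at this; linarith)
  have hQ : ∀ x y, (fun Z => P Z - deriv P 0 * Z) x = (fun Z => P Z - deriv P 0 * Z) y := by
    apply is_const_of_deriv_eq_zero (by fun_prop)
    intro x
    have : HasDerivAt (fun Z => P Z - deriv P 0 * Z) (deriv P x - deriv P 0 * 1) x :=
      (hP x).hasDerivAt.sub ((hasDerivAt_id x).const_mul _)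
    rw [this.deriv, hd x 0]; ring
  intro Z
  have := hQ Z 0
  simp only at this
  linarith

/-- **Theorem 1 (shrinking-window version).**
Let `T₀ < T`, `γ > 0`, and let `δ : (T₀,T) → (0,∞)` be decreasing with `δ(t) → 0` as
`t → T⁻` and `limsup_{t→T⁻} (T−t)^{−γ} δ(t) = ∞`.  Let `(u₁, ω₁, ψ₁)` be a classical
solution of the reduced axisymmetric Euler system on
`𝒲 = {(r,z,t) : 1−δ(t) < r < 1, −δ(t) < z < δ(t), T₀ < t < T}`, admitting the
self-similar representation with profiles `U, Ω ∈ C¹(𝒟)`, `Ψ ∈ C²(𝒟)` on the closed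
left half-plane, where `R = (r−1)(T−t)^{−γ}`, `Z = z(T−t)^{−γ}` (real powers).
Assume `sup_{R ≤ 0}(|U(R,Z)| + |Ω(R,Z)|) → 0` as `|Z| → ∞`.  Then `u₁ ≡ 0`, `ω₁ ≡ 0`
on `𝒲`, and there are constants `a, b` with
`ψ₁(r,z,t) = a (T−t)^{−1+γ} z + b (T−t)^{−1+2γ}` on `𝒲`. -/
theorem luo_hou_ansatz_trivial_shrinking_window
    (T₀ T γ : ℝ) (hT : T₀ < T) (hγ : 0 < γ)
    (δ : ℝ → ℝ)
    (hδpos : ∀ t ∈ Set.Ioo T₀ T, 0 < δ t)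
    (hδdecr : AntitoneOn δ (Set.Ioo T₀ T))
    (hδ0 : Tendsto δ (nhdsWithin T (Set.Iio T)) (nhds 0))
    (hδlimsup : ∀ M : ℝ, ∃ᶠ t in nhdsWithin T (Set.Iio T),
      t ∈ Set.Ioo T₀ T ∧ M < (T - t) ^ (-γ) * δ t)
    (u1 ω1 ψ1 : ℝ → ℝ → ℝ → ℝ) (U W Ψ : ℝ → ℝ → ℝ)
    (inW : ℝ → ℝ → ℝ → Prop)
    (hinW : ∀ r z t : ℝ, inW r z t ↔
      (1 - δ t < r ∧ r < 1 ∧ -δ t < z ∧ z < δ t ∧ T₀ < t ∧ t < T))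
    -- regularity of the classical solution: `u₁, ω₁` are `C¹`, `ψ₁` is `C¹` in all
    -- variables and `C²` in `(r,z)` for each fixed `t`
    (hu1reg : ContDiffOn ℝ 1 (fun q : ℝ × ℝ × ℝ => u1 q.1 q.2.1 q.2.2)
      {q : ℝ × ℝ × ℝ | inW q.1 q.2.1 q.2.2})
    (hω1reg : ContDiffOn ℝ 1 (fun q : ℝ × ℝ × ℝ => ω1 q.1 q.2.1 q.2.2)
      {q : ℝ × ℝ × ℝ | inW q.1 q.2.1 q.2.2})
    (hψ1reg : ContDiffOn ℝ 1 (fun q : ℝ × ℝ × ℝ => ψ1 q.1 q.2.1 q.2.2)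
      {q : ℝ × ℝ × ℝ | inW q.1 q.2.1 q.2.2})
    (hψ1reg2 : ∀ t ∈ Set.Ioo T₀ T, ContDiffOn ℝ 2 (fun q : ℝ × ℝ => ψ1 q.1 q.2 t)
      {q : ℝ × ℝ | 1 - δ t < q.1 ∧ q.1 < 1 ∧ -δ t < q.2 ∧ q.2 < δ t})
    -- the reduced axisymmetric Euler system, with
    -- `uʳ = −r ∂_z ψ₁` and `u^z = 2ψ₁ + r ∂_r ψ₁`
    (heq1 : ∀ r z t : ℝ, inW r z t →
      pdt u1 r z t + (-(r * pdz ψ1 r z t)) * pdr u1 r z t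
        + (2 * ψ1 r z t + r * pdr ψ1 r z t) * pdz u1 r z t
        = 2 * u1 r z t * pdz ψ1 r z t)
    (heq2 : ∀ r z t : ℝ, inW r z t →
      pdt ω1 r z t + (-(r * pdz ψ1 r z t)) * pdr ω1 r z t
        + (2 * ψ1 r z t + r * pdr ψ1 r z t) * pdz ω1 r z t
        = pdz (fun a b c => (u1 a b c) ^ 2) r z t)
    (heq3 : ∀ r z t : ℝ, inW r z t →
      -(pdr (pdr ψ1) r z t + (3 / r) * pdr ψ1 r z t + pdz (pdz ψ1) r z t)
        = ω1 r z t)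
    -- regularity of the blow-up profiles on the left half-plane
    (hUreg : ContDiffOn ℝ 1 (fun q : ℝ × ℝ => U q.1 q.2) {q : ℝ × ℝ | q.1 ≤ 0})
    (hWreg : ContDiffOn ℝ 1 (fun q : ℝ × ℝ => W q.1 q.2) {q : ℝ × ℝ | q.1 ≤ 0})
    (hΨreg : ContDiffOn ℝ 2 (fun q : ℝ × ℝ => Ψ q.1 q.2) {q : ℝ × ℝ | q.1 ≤ 0})
    -- the self-similar ansatz
    (hrepu : ∀ r z t : ℝ, inW r z t →
      u1 r z t = (T - t) ^ (-1 + γ / 2) *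
        U ((r - 1) * (T - t) ^ (-γ)) (z * (T - t) ^ (-γ)))
    (hrepω : ∀ r z t : ℝ, inW r z t →
      ω1 r z t = (T - t) ^ (-(1 : ℝ)) *
        W ((r - 1) * (T - t) ^ (-γ)) (z * (T - t) ^ (-γ)))
    (hrepψ : ∀ r z t : ℝ, inW r z t →
      ψ1 r z t = (T - t) ^ (-1 + 2 * γ) *
        Ψ ((r - 1) * (T - t) ^ (-γ)) (z * (T - t) ^ (-γ)))
    -- decay condition: `sup_{R ≤ 0}(|U| + |Ω|) → 0` as `|Z| → ∞`
    (hdecay : ∀ ε > 0, ∃ M : ℝ, ∀ R ≤ (0 : ℝ), ∀ Z : ℝ,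
      M < |Z| → |U R Z| + |W R Z| < ε) :
    (∀ r z t : ℝ, inW r z t → u1 r z t = 0 ∧ ω1 r z t = 0)
    ∧ ∃ a b : ℝ, ∀ r z t : ℝ, inW r z t →
        ψ1 r z t = a * (T - t) ^ (-1 + γ) * z + b * (T - t) ^ (-1 + 2 * γ) := by
  set k : ℝ → ℝ := fun t => (T - t) ^ (-γ) with hk
  have key := window_key T₀ T γ hγ δ hδdecr hδ0 hδlimsup inW hinW
  -- two good times
  have two : ∀ R Z : ℝ, R < 0 → ∃ t₁ t₂ : ℝ, t₁ < T ∧ t₂ < T ∧ (T - t₁) ^ γ ≠ (T - t₂) ^ γ ∧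
      ∀ t, t = t₁ ∨ t = t₂ → 0 < 1 + R * (T - t) ^ γ ∧
        ∀ᶠ q : ℝ × ℝ × ℝ in nhds (1 + R * (T - t) ^ γ, Z * (T - t) ^ γ, t),
          inW q.1 q.2.1 q.2.2 := by
    intro R Z hR
    obtain ⟨ta, tb, hab, h⟩ := key R Z hR
    have m1 : (2 * ta + tb) / 3 ∈ Set.Ioo ta tb := ⟨by linarith, by linarith⟩
    have m2 : (ta + 2 * tb) / 3 ∈ Set.Ioo ta tb := ⟨by linarith, by linarith⟩
    refine ⟨_, _, (h _ m1).1, (h _ m2).1, ?_, ?_⟩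
    · have := Real.rpow_lt_rpow (x := T - (ta + 2 * tb) / 3) (y := T - (2 * ta + tb) / 3)
        (by linarith [(h _ m2).1]) (by linarith) hγ
      exact this.ne'
    · rintro t (rfl | rfl)
      · exact (h _ m1).2
      · exact (h _ m2).2
  have alg : ∀ t, t < T → 0 < T - t ∧ 0 < (T - t) ^ γ ∧ k t = ((T - t) ^ γ)⁻¹ ∧
      (T - t) ^ (-1 + 2 * γ) = (T - t)⁻¹ * ((T - t) ^ γ) ^ 2 ∧
      ((T - t) ^ (-1 + γ / 2)) ^ 2 = ((T - t)⁻¹) ^ 2 * (T - t) ^ γ ∧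
      (T - t) ^ (-(1 : ℝ)) = (T - t)⁻¹ ∧
      (T - t) ^ (-1 + γ) = (T - t)⁻¹ * (T - t) ^ γ := by
    intro t ht
    have hτ : 0 < T - t := by linarith
    have e1 : (T - t) ^ (-(1 : ℝ)) = (T - t)⁻¹ := Real.rpow_neg_one _
    refine ⟨hτ, Real.rpow_pos_of_pos hτ _, Real.rpow_neg hτ.le _, ?_, ?_, e1, ?_⟩
    · rw [Real.rpow_add hτ, e1, mul_comm 2 γ, Real.rpow_mul hτ.le]; norm_num
    · rw [Real.rpow_add hτ, e1, mul_pow, ← Real.rpow_natCast ((T - t) ^ (γ / 2)),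
        ← Real.rpow_mul hτ.le]
      congr 2; push_cast; ring
    · rw [Real.rpow_add hτ, e1]
  have self : ∀ t, t < T → ∀ X : ℝ, X * (T - t) ^ γ * k t = X := by
    intro t ht X
    obtain ⟨h1, h2, h3, -⟩ := alg t ht
    rw [h3]; field_simp
  have self' : ∀ t, t < T → ∀ X : ℝ, (1 + X * (T - t) ^ γ - 1) * k t = X := by
    intro t ht X
    rw [add_sub_cancel_left]; exact self t ht X
  -- regularity of slices
  have nh : ∀ R Z : ℝ, R < 0 → {q : ℝ × ℝ | q.1 ≤ 0} ∈ nhds (R, Z) := by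
    intro R Z hR
    filter_upwards [(isOpen_lt (f := fun q : ℝ × ℝ => q.1) (g := fun _ => (0:ℝ))
      (by fun_prop) (by fun_prop)).mem_nhds (x := (R, Z)) hR] with q hq
    exact le_of_lt hq
  set ΨR : ℝ → ℝ → ℝ := fun R Z => deriv (fun x => Ψ x Z) R with hΨR
  set ΨZ : ℝ → ℝ → ℝ := fun R Z => deriv (fun x => Ψ R x) Z with hΨZ
  set inO : ℝ → ℝ → ℝ → Prop := fun r z t =>
    ∀ᶠ q : ℝ × ℝ × ℝ in nhds (r, z, t), inW q.1 q.2.1 q.2.2 with hinO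
  have repR : ∀ r z t, inO r z t → pdr ψ1 r z t =
      ((T - t) ^ (-1 + 2 * γ) * k t) * ΨR ((r - 1) * k t) (z * k t) :=
    fun r z t h => rep_pdr inW ψ1 Ψ (fun t => (T - t) ^ (-1 + 2 * γ)) k hrepψ r z t h
  have repZ : ∀ r z t, inO r z t → pdz ψ1 r z t =
      ((T - t) ^ (-1 + 2 * γ) * k t) * ΨZ ((r - 1) * k t) (z * k t) :=
    fun r z t h => rep_pdz inW ψ1 Ψ (fun t => (T - t) ^ (-1 + 2 * γ)) k hrepψ r z t h
  have repRR : ∀ r z t, inO r z t → pdr (pdr ψ1) r z t =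
      ((T - t) ^ (-1 + 2 * γ) * k t * k t) *
        deriv (fun x => ΨR x (z * k t)) ((r - 1) * k t) :=
    fun r z t h => rep_pdr inO (pdr ψ1) ΨR (fun t => (T - t) ^ (-1 + 2 * γ) * k t) k repR r z t
      (eventually_eventually_nhds.2 h)
  have repZZ : ∀ r z t, inO r z t → pdz (pdz ψ1) r z t =
      ((T - t) ^ (-1 + 2 * γ) * k t * k t) *
        deriv (fun x => ΨZ ((r - 1) * k t) x) (z * k t) :=
    fun r z t h => rep_pdz inO (pdz ψ1) ΨZ (fun t => (T - t) ^ (-1 + 2 * γ) * k t) k repZ r z t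
      (eventually_eventually_nhds.2 h)
  have E3 : ∀ R Z t, t < T → 0 < 1 + R * (T - t) ^ γ →
      inO (1 + R * (T - t) ^ γ) (Z * (T - t) ^ γ) t →
      -(deriv (fun x => ΨR x Z) R + 3 * ((T - t) ^ γ / (1 + R * (T - t) ^ γ)) * ΨR R Z
        + deriv (fun x => ΨZ R x) Z) = W R Z := by
    intro R Z t ht hr hO
    have hI : inW (1 + R * (T - t) ^ γ) (Z * (T - t) ^ γ) t := hO.self_of_nhds
    have h := heq3 _ _ _ hI
    have hW := hrepω _ _ _ hI
    change _ = _ * W (_ * k t) (_ * k t) at hW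
    rw [hW, repRR _ _ _ hO, repZZ _ _ _ hO, repR _ _ _ hO, self' t ht, self t ht] at h
    obtain ⟨h1, h2, h3, h4, -, h6, -⟩ := alg t ht
    rw [h3, h4, h6] at h
    have hr' := hr.ne'
    set s := (T - t) ^ γ
    generalize ΨR R Z = a at *
    generalize deriv (fun x => ΨR x Z) R = b at *
    generalize deriv (fun x => ΨZ R x) Z = c at *
    have h1' := h1.ne'
    have h2' := h2.ne'
    have h' := congrArg (fun x => (T - t) * x) h
    field_simp at h' ⊢
    linarith
  have hΨR0 : ∀ R Z, R < 0 → ΨR R Z = 0 := by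
    intro R Z hR
    obtain ⟨t₁, t₂, l1, l2, hne, h⟩ := two R Z hR
    obtain ⟨p1, o1⟩ := h t₁ (Or.inl rfl)
    obtain ⟨p2, o2⟩ := h t₂ (Or.inr rfl)
    have a1 := E3 R Z t₁ l1 p1 o1
    have a2 := E3 R Z t₂ l2 p2 o2
    generalize (T - t₁) ^ γ = s1 at *
    generalize (T - t₂) ^ γ = s2 at *
    have : (s1 / (1 + R * s1) - s2 / (1 + R * s2)) * ΨR R Z = 0 := by linarith
    rcases mul_eq_zero.1 this with h0 | h0
    · exfalso; apply hne
      rw [sub_eq_zero, div_eq_div_iff p1.ne' p2.ne'] at h0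
      linarith
    · exact h0
  have cΨ : ∀ R Z, R < 0 → ContDiffAt ℝ 2 (fun q : ℝ × ℝ => Ψ q.1 q.2) (R, Z) :=
    fun R Z hR => hΨreg.contDiffAt (nh R Z hR)
  have hΨc : ∀ R Z, R < 0 → Ψ R Z = Ψ (-1) Z := by
    intro R Z hR
    refine const_of_deriv_zero_left (fun x => Ψ x Z) (fun x hx => ?_) (fun x hx => hΨR0 x Z hx) R hR
    have := (cΨ x Z hx).differentiableAt two_ne_zero
    exact this.comp (f := fun x : ℝ => (x, Z)) x (by fun_prop)
  set P : ℝ → ℝ := fun Z => Ψ (-1) Z with hPdef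
  have hPc : ContDiff ℝ 2 P := by
    rw [contDiff_iff_contDiffAt]
    intro Z
    exact (cΨ (-1) Z (by norm_num)).comp (f := fun x : ℝ => ((-1 : ℝ), x)) Z (by fun_prop)
  set w : ℝ → ℝ := fun Z => W (-1) Z with hwdef
  have hwc : ContDiff ℝ 1 w := by
    rw [contDiff_iff_contDiffAt]
    intro Z
    exact (hWreg.contDiffAt (nh (-1) Z (by norm_num))).comp
      (f := fun x : ℝ => ((-1 : ℝ), x)) Z (by fun_prop)
  have hWP : ∀ R Z, R < 0 → W R Z = - deriv (deriv P) Z := by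
    intro R Z hR
    obtain ⟨t₁, t₂, l1, l2, hne, h⟩ := two R Z hR
    obtain ⟨p1, o1⟩ := h t₁ (Or.inl rfl)
    have a1 := E3 R Z t₁ l1 p1 o1
    have b1 : deriv (fun x => ΨR x Z) R = 0 := by
      have : (fun x => ΨR x Z) =ᶠ[nhds R] fun _ => 0 := by
        filter_upwards [gt_mem_nhds hR] with x hx
        exact hΨR0 x Z hx
      rw [this.deriv_eq]; simp
    have b2 : (fun x => ΨZ R x) = deriv P := by
      ext x
      have : (fun y => Ψ R y) = P := by ext y; exact hΨc R y hR
      simp only [hΨZ, this]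
    rw [b1, hΨR0 R Z hR, b2] at a1
    linarith
  have hWw : ∀ R Z, R < 0 → W R Z = w Z := fun R Z hR => by
    rw [hWP R Z hR]; exact (hWP (-1) Z (by norm_num)).symm
  have hkneg : ∀ r t, r < 1 → t < T → (r - 1) * k t < 0 := fun r t hr ht =>
    mul_neg_of_neg_of_pos (by linarith) (Real.rpow_pos_of_pos (by linarith) _)
  have repω' : ∀ r z t, inW r z t → ω1 r z t = (T - t) ^ (-(1:ℝ)) *
      (fun _ Z => w Z) ((r - 1) * k t) (z * k t) := by
    intro r z t h
    obtain ⟨-, hr, -, -, -, ht⟩ := (hinW _ _ _).1 h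
    rw [hrepω r z t h]
    change _ * W (_ * k t) (_ * k t) = _
    rw [hWw _ _ (hkneg r t hr ht)]
  have repu2 : ∀ r z t, inW r z t → (fun a b c => (u1 a b c) ^ 2) r z t =
      ((T - t) ^ (-1 + γ / 2)) ^ 2 *
      (fun R Z => (U R Z) ^ 2) ((r - 1) * k t) (z * k t) := by
    intro r z t h
    simp only [hrepu r z t h, mul_pow, hk]
  have E2 : ∀ R Z t, R < 0 → t < T →
      inO (1 + R * (T - t) ^ γ) (Z * (T - t) ^ γ) t →
      w Z + γ * Z * deriv w Z + 2 * (T - t) ^ γ * (P Z * deriv w Z)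
        = deriv (fun x => (U R x) ^ 2) Z := by
    intro R Z t hR ht hO
    have hI : inW (1 + R * (T - t) ^ γ) (Z * (T - t) ^ γ) t := hO.self_of_nhds
    have h := heq2 _ _ _ hI
    have dr := rep_pdr inW ω1 (fun _ Z => w Z) (fun t => (T - t) ^ (-(1:ℝ))) k repω' _ _ _ hO
    have dz := rep_pdz inW ω1 (fun _ Z => w Z) (fun t => (T - t) ^ (-(1:ℝ))) k repω' _ _ _ hO
    have du := rep_pdz inW (fun a b c => (u1 a b c) ^ 2) (fun R Z => (U R Z) ^ 2)
      (fun t => ((T - t) ^ (-1 + γ / 2)) ^ 2) k repu2 _ _ _ hO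
    have hψ := hrepψ _ _ _ hI
    change _ = _ * Ψ (_ * k t) (_ * k t) at hψ
    rw [self' t ht, self t ht] at hψ dr du
    rw [self t ht] at dz
    have hR0 := repR _ _ _ hO
    rw [self' t ht, self t ht, hΨR0 R Z hR] at hR0
    obtain ⟨h1, h2, h3, h4, h5, h6, -⟩ := alg t ht
    have dt : pdt ω1 (1 + R * (T - t) ^ γ) (Z * (T - t) ^ γ) t =
        ((T - t)⁻¹) ^ 2 * (w Z + γ * Z * deriv w Z) := by
      have c1 : Tendsto (fun x : ℝ => (1 + R * (T - t) ^ γ, Z * (T - t) ^ γ, x)) (nhds t)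
          (nhds (1 + R * (T - t) ^ γ, Z * (T - t) ^ γ, t)) :=
        (Continuous.prodMk continuous_const
          (Continuous.prodMk continuous_const continuous_id)).tendsto t
      have c2 : (fun x => ω1 (1 + R * (T - t) ^ γ) (Z * (T - t) ^ γ) x) =ᶠ[nhds t]
          fun x => (T - x) ^ (-(1:ℝ)) * w (Z * (T - t) ^ γ * (T - x) ^ (-γ)) := by
        filter_upwards [c1.eventually hO] with x hx
        exact repω' _ _ _ hx
      have d0 : HasDerivAt (fun x => T - x) (-1) t := by
        simpa using (hasDerivAt_id t).const_sub T
      have d1 := d0.rpow_const (p := -(1:ℝ)) (Or.inl h1.ne')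
      have d2 := (d0.rpow_const (p := -γ) (Or.inl h1.ne')).const_mul (Z * (T - t) ^ γ)
      have hw1 : HasDerivAt w (deriv w Z) (Z * (T - t) ^ γ * (T - t) ^ (-γ)) := by
        have := self t ht Z
        simp only [hk] at this
        rw [this]
        exact ((hwc.differentiable one_ne_zero) Z).hasDerivAt
      have d3 := HasDerivAt.comp t hw1 d2
      have d4 := d1.mul d3
      unfold pdt
      rw [c2.deriv_eq]
      refine d4.deriv.trans ?_
      have e1 : (T - t) ^ (-(1:ℝ) - 1) = ((T - t)⁻¹) ^ 2 := by
        rw [Real.rpow_sub h1, h6, Real.rpow_one]; field_simp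
      have e2 : (T - t) ^ (-γ - 1) = ((T - t) ^ γ)⁻¹ * (T - t)⁻¹ := by
        rw [Real.rpow_sub h1, Real.rpow_neg h1.le, Real.rpow_one]; field_simp
      have e3 : Z * (T - t) ^ γ * (T - t) ^ (-γ) = Z := self t ht Z
      simp only [Function.comp]
      rw [e1, e2, e3, h6]
      have h2' := h2.ne'
      have h1' := h1.ne'
      field_simp
    rw [dt, dr, dz, du, hψ, hR0, hΨc R Z hR, h3, h4, h5, h6] at h
    simp only [deriv_const, mul_zero, add_zero] at h
    change _ = _ * deriv (fun x => (U R x) ^ 2) Z at h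
    change _ + _ * (_ * deriv w Z) = _ at h
    have h1' := h1.ne'
    have h2' := h2.ne'
    have hPZ : Ψ (-1) Z = P Z := rfl
    try rw [hPZ] at h
    generalize deriv (fun x => (U R x) ^ 2) Z = d at *
    generalize (T - t) ^ γ = s at *
    field_simp at h
    linarith
  have hPw : ∀ Z, P Z * deriv w Z = 0 := by
    intro Z
    obtain ⟨t₁, t₂, l1, l2, hne, h⟩ := two (-1) Z (by norm_num)
    have a1 := E2 (-1) Z t₁ (by norm_num) l1 (h t₁ (Or.inl rfl)).2
    have a2 := E2 (-1) Z t₂ (by norm_num) l2 (h t₂ (Or.inr rfl)).2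
    have : ((T - t₁) ^ γ - (T - t₂) ^ γ) * (P Z * deriv w Z) = 0 := by linarith
    exact (mul_eq_zero.1 this).resolve_left (sub_ne_zero.2 hne)
  obtain ⟨hw0, a, b, hab⟩ := ode_part P w (hPc.differentiable two_ne_zero)
    ((ContDiff.differentiable_deriv_two hPc)) hwc
    (fun Z => hWP (-1) Z (by norm_num)) hPw (by
      intro ε hε
      obtain ⟨M, hM⟩ := hdecay ε hε
      refine ⟨M, fun Z hZ => ?_⟩
      have := hM (-1) (by norm_num) Z hZ
      have h0 := abs_nonneg (U (-1) Z)
      change |W (-1) Z| < ε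
      linarith)
  have hw0' : ∀ Z, deriv w Z = 0 := by
    intro Z
    have : w = fun _ => 0 := funext hw0
    rw [this]; simp
  have hU0 : ∀ R Z, R < 0 → U R Z = 0 := by
    intro R Z hR
    have hd : ∀ x, deriv (fun x => (U R x) ^ 2) x = 0 := by
      intro x
      obtain ⟨t₁, t₂, l1, l2, hne, h⟩ := two R x hR
      have a1 := E2 R x t₁ hR l1 (h t₁ (Or.inl rfl)).2
      rw [hw0, hw0'] at a1
      linarith
    have hdiff : Differentiable ℝ (fun x => (U R x) ^ 2) := by
      intro x
      have h1 := (hUreg.contDiffAt (nh R x hR)).differentiableAt one_ne_zero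
      have h2 : DifferentiableAt ℝ (fun x => U R x) x :=
        h1.comp (f := fun x : ℝ => (R, x)) x (by fun_prop)
      exact h2.pow 2
    have hc := is_const_of_deriv_eq_zero hdiff hd
    by_contra hne
    obtain ⟨M, hM⟩ := hdecay |U R Z| (abs_pos.2 hne)
    have h1 := hM R hR.le (|M| + 1) (by
      rw [abs_of_pos (by positivity)]; linarith [le_abs_self M])
    have h2 : |U R (|M| + 1)| = |U R Z| := (sq_eq_sq_iff_abs_eq_abs _ _).1 (hc _ _)
    have h3 := abs_nonneg (W R (|M| + 1))
    linarith
  refine ⟨fun r z t h => ?_, a, b, fun r z t h => ?_⟩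
  · obtain ⟨-, hr, -, -, -, ht⟩ := (hinW _ _ _).1 h
    have hn := hkneg r t hr ht
    constructor
    · rw [hrepu r z t h, hU0 _ _ hn, mul_zero]
    · rw [hrepω r z t h, hWw _ _ hn, hw0, mul_zero]
  · obtain ⟨-, hr, -, -, -, ht⟩ := (hinW _ _ _).1 h
    have hn := hkneg r t hr ht
    obtain ⟨h1, h2, h3, h4, -, -, h7⟩ := alg t ht
    rw [hrepψ r z t h, hΨc _ _ hn]
    change _ * P (z * k t) = _
    rw [hab, h3, h4, h7]
    have h1' := h1.ne'
    have h2' := h2.ne'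
    field_simp
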